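/- arXiv:2207.01655 — 2 statements merged into one kernel-verified Lean document; each statement's English description precedes it below -/
import Mathlib

section
/- Let Ω ⊂ ℝ^N be a bounded domain, ε > 0, and let f : ℝ^N → ℝ and g : ℝ^N → ℝ be bounded Borel measurable functions. Then there exists a unique bounded Borel measurable function u : ℝ^N → ℝ such that u = g on ℝ^N ∖ Ω and u satisfies the dynamic programming principle u(x) = α ∫ u(x+εz) dν_x(z) + β ⨍_{B_ε(x)} u(y) dy + ε² f(x) for every x ∈ Ω. -/
open MeasureTheory Metric

open ProbabilityTheory

/-- A bounded measurable real function is integrable against a finite measure. -/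
theorem integrable_of_measurable_of_bounded {E : Type*} [MeasurableSpace E] {μ : Measure E}
    [IsFiniteMeasure μ] {u : E → ℝ} (hu : Measurable u) (hb : ∃ M, ∀ x, |u x| ≤ M) :
    Integrable u μ := by
  obtain ⟨M, hM⟩ := hb
  exact Integrable.of_bound hu.aestronglyMeasurable M (Filter.Eventually.of_forall hM)

/-- Existence and uniqueness of bounded solutions of `u x = ∫ u d(Q x) + F x` in `Ω` with `u = g`
outside, given a nonnegative bounded barrier `φ` with `φ ≥ 1` on `Ω` that the averaging operator
contracts by a factor `r < 1`. -/
theorem existsUnique_of_barrier {E : Type*} [MeasurableSpace E] (Q : E → Measure E)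
    [∀ x, IsProbabilityMeasure (Q x)]
    (hQ : ∀ u : E → ℝ, Measurable u → (∃ M, ∀ x, |u x| ≤ M) → Measurable fun x => ∫ y, u y ∂(Q x))
    {Ω : Set E} (hΩ : MeasurableSet Ω) {F g : E → ℝ}
    (hF : Measurable F) (hFb : ∃ M, ∀ x, |F x| ≤ M)
    (hg : Measurable g) (hgb : ∃ M, ∀ x, |g x| ≤ M)
    {φ : E → ℝ} (hφ : Measurable φ) (hφ0 : ∀ x, 0 ≤ φ x) {C : ℝ} (hφC : ∀ x, φ x ≤ C)
    (hφ1 : ∀ x ∈ Ω, 1 ≤ φ x) {r : ℝ} (hr0 : 0 ≤ r) (hr1 : r < 1)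
    (hφr : ∀ x ∈ Ω, ∫ y, φ y ∂(Q x) ≤ r * φ x) :
    ∃! u : E → ℝ, Measurable u ∧ (∃ M, ∀ x, |u x| ≤ M) ∧ (∀ x, x ∉ Ω → u x = g x) ∧
      (∀ x ∈ Ω, u x = ∫ y, u y ∂(Q x) + F x) := by
  classical
  have hφb : ∃ M, ∀ x, |φ x| ≤ M := ⟨C, fun x => by rw [abs_of_nonneg (hφ0 x)]; exact hφC x⟩
  have contract : ∀ (u v : E → ℝ) (M : ℝ), 0 ≤ M → Measurable u → (∃ M, ∀ x, |u x| ≤ M) →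
      Measurable v → (∃ M, ∀ x, |v x| ≤ M) → (∀ x, |u x - v x| ≤ M * φ x) →
      ∀ x ∈ Ω, |∫ y, u y ∂(Q x) - ∫ y, v y ∂(Q x)| ≤ M * r * φ x := by
    intro u v M hM hu hub hv hvb huv x hx
    rw [← integral_sub (integrable_of_measurable_of_bounded hu hub)
      (integrable_of_measurable_of_bounded hv hvb)]
    calc |∫ y, (u y - v y) ∂(Q x)| ≤ ∫ y, M * φ y ∂(Q x) :=
          norm_integral_le_of_norm_le (f := fun y => u y - v y)
            ((integrable_of_measurable_of_bounded hφ hφb).const_mul M)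
            (Filter.Eventually.of_forall huv)
      _ = M * ∫ y, φ y ∂(Q x) := integral_const_mul _ _
      _ ≤ M * (r * φ x) := mul_le_mul_of_nonneg_left (hφr x hx) hM
      _ = M * r * φ x := by ring
  let T : (E → ℝ) → E → ℝ := fun u x => if x ∈ Ω then ∫ y, u y ∂(Q x) + F x else g x
  have hT : ∀ u, (Measurable u ∧ ∃ M, ∀ x, |u x| ≤ M) →
      (Measurable (T u) ∧ ∃ M, ∀ x, |T u x| ≤ M) := by
    rintro u ⟨hu, M, hM⟩
    refine ⟨Measurable.ite hΩ ((hQ u hu ⟨M, hM⟩).add hF) hg, ?_⟩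
    obtain ⟨A, hA⟩ := hFb
    obtain ⟨B, hB⟩ := hgb
    refine ⟨max (M + A) B, fun x => ?_⟩
    by_cases hx : x ∈ Ω
    · simp only [T, if_pos hx]
      refine le_max_of_le_left ((abs_add_le _ _).trans (add_le_add ?_ (hA x)))
      simpa using norm_integral_le_of_norm_le_const (μ := Q x) (f := u)
        (Filter.Eventually.of_forall hM)
    · simp only [T, if_neg hx]
      exact le_max_of_le_right (hB x)
  let U : ℕ → E → ℝ := fun n => T^[n] g
  have hUs : ∀ n, U (n + 1) = T (U n) := fun n => Function.iterate_succ_apply' T n g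
  have hU : ∀ n, Measurable (U n) ∧ ∃ M, ∀ x, |U n x| ≤ M := by
    intro n
    induction n with
    | zero => exact ⟨hg, hgb⟩
    | succ n ih => rw [hUs]; exact hT _ ih
  obtain ⟨M₀, hM₀⟩ := (hU 0).2
  obtain ⟨M₁, hM₁⟩ := (hU 1).2
  have hTout : ∀ u x, x ∉ Ω → T u x = g x := fun u x hx => if_neg hx
  have hTin : ∀ u x, x ∈ Ω → T u x = ∫ y, u y ∂(Q x) + F x := fun u x hx => if_pos hx
  have hUout : ∀ n x, x ∉ Ω → U n x = g x := by
    intro n x hx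
    cases n with
    | zero => rfl
    | succ n => rw [hUs]; exact hTout _ _ hx
  let M := |M₀| + |M₁|
  have hM : 0 ≤ M := by positivity
  have hstep : ∀ n x, |U n x - U (n + 1) x| ≤ M * r ^ n * φ x := by
    intro n
    induction n with
    | zero =>
      intro x
      by_cases hx : x ∈ Ω
      · have h1 : |U 0 x - U 1 x| ≤ M :=
          (abs_sub _ _).trans (add_le_add ((hM₀ x).trans (le_abs_self _))
            ((hM₁ x).trans (le_abs_self _)))
        simpa using h1.trans (le_mul_of_one_le_right hM (hφ1 x hx))
      · rw [hUout _ _ hx, hUout _ _ hx, sub_self, abs_zero]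
        exact mul_nonneg (by positivity) (hφ0 x)
    | succ n ih =>
      intro x
      by_cases hx : x ∈ Ω
      · rw [hUs (n + 1), hTin _ _ hx, hUs n, hTin _ _ hx, add_sub_add_right_eq_sub, ← hUs n]
        have := contract (U n) (U (n + 1)) (M * r ^ n) (by positivity) (hU _).1 (hU _).2
          (hU _).1 (hU _).2 ih x hx
        rwa [mul_assoc M, ← pow_succ] at this
      · rw [hUout _ _ hx, hUout _ _ hx, sub_self, abs_zero]
        exact mul_nonneg (by positivity) (hφ0 x)
  have hgeom : ∀ x n, dist (U n x) (U (n + 1) x) ≤ (M * C) * r ^ n := fun x n => by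
    rw [Real.dist_eq]
    calc _ ≤ M * r ^ n * φ x := hstep n x
      _ ≤ M * r ^ n * C := by gcongr; exact hφC x
      _ = _ := by ring
  choose u hu using fun x => cauchySeq_tendsto_of_complete
    (cauchySeq_of_le_geometric r (M * C) hr1 (hgeom x))
  have hdist : ∀ n x, |U n x - u x| ≤ |M * C / (1 - r)| := fun n x => by
    have h := dist_le_of_le_geometric_of_tendsto r (M * C) hr1 (hgeom x) (hu x) n
    rw [Real.dist_eq] at h
    have h2 : |M * C * r ^ n / (1 - r)| ≤ |M * C / (1 - r)| := by
      rw [mul_div_right_comm, abs_mul, abs_of_nonneg (pow_nonneg hr0 n)]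
      exact mul_le_of_le_one_right (abs_nonneg _) (pow_le_one₀ hr0 hr1.le)
    exact h.trans ((le_abs_self _).trans h2)
  have humeas : Measurable u :=
    measurable_of_tendsto_metrizable (fun n => (hU n).1) (tendsto_pi_nhds.2 hu)
  have hub : ∀ x, |u x| ≤ M₀ + |M * C / (1 - r)| := fun x => by
    have h1 := abs_sub_abs_le_abs_sub (u x) (U 0 x)
    rw [abs_sub_comm] at h1
    linarith [hdist 0 x, hM₀ x]
  have huout : ∀ x, x ∉ Ω → u x = g x := fun x hx =>
    tendsto_nhds_unique (hu x) (by simp only [hUout _ _ hx]; exact tendsto_const_nhds)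
  have huin : ∀ x ∈ Ω, u x = ∫ y, u y ∂(Q x) + F x := by
    intro x hx
    have h1 : Filter.Tendsto (fun n => U (n + 1) x) Filter.atTop (nhds (u x)) :=
      (hu x).comp (Filter.tendsto_add_atTop_nat 1)
    refine tendsto_nhds_unique h1 ?_
    simp only [hUs, hTin _ _ hx]
    refine Filter.Tendsto.add_const _ ?_
    refine tendsto_integral_of_dominated_convergence
      (fun _ => M₀ + |M * C / (1 - r)| + |M * C / (1 - r)|)
      (fun n => (hU n).1.aestronglyMeasurable) (integrable_const _) (fun n => ?_)
      (Filter.Eventually.of_forall hu)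
    refine Filter.Eventually.of_forall fun y => ?_
    have h1 := abs_sub_abs_le_abs_sub (U n y) (u y)
    rw [Real.norm_eq_abs]
    linarith [hdist n y, hub y]
  refine ⟨u, ⟨humeas, ⟨_, hub⟩, huout, huin⟩, ?_⟩
  · rintro v ⟨hv, ⟨A, hA⟩, hvout, hvin⟩
    let D := |A| + |(M₀ + |M * C / (1 - r)|)|
    have key : ∀ n x, |v x - u x| ≤ D * r ^ n * φ x := by
      intro n
      induction n with
      | zero =>
        intro x
        by_cases hx : x ∈ Ω
        · have h1 : |v x - u x| ≤ D :=
            (abs_sub _ _).trans (add_le_add ((hA x).trans (le_abs_self _))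
              ((hub x).trans (le_abs_self _)))
          simpa using h1.trans (le_mul_of_one_le_right (by positivity) (hφ1 x hx))
        · rw [hvout _ hx, huout _ hx, sub_self, abs_zero]
          exact mul_nonneg (by positivity) (hφ0 x)
      | succ n ih =>
        intro x
        by_cases hx : x ∈ Ω
        · rw [hvin _ hx, huin _ hx, add_sub_add_right_eq_sub]
          have := contract v u (D * r ^ n) (by positivity) hv ⟨A, hA⟩ humeas ⟨_, hub⟩ ih x hx
          rwa [mul_assoc D, ← pow_succ] at this
        · rw [hvout _ hx, huout _ hx, sub_self, abs_zero]
          exact mul_nonneg (by positivity) (hφ0 x)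
    funext x
    have hlim : Filter.Tendsto (fun n : ℕ => D * r ^ n * φ x) Filter.atTop (nhds 0) := by
      simpa using ((tendsto_pow_atTop_nhds_zero_of_lt_one hr0 hr1).const_mul D).mul_const (φ x)
    have h0 := ge_of_tendsto' hlim fun n => key n x
    exact sub_eq_zero.1 (abs_nonpos_iff.1 h0)

/-- For a symmetric probability measure with bounded support, `∫ ‖x + z‖² = ‖x‖² + ∫ ‖z‖²`. -/
theorem integral_norm_add_sq_of_symmetric {E : Type*} [NormedAddCommGroup E]
    [InnerProductSpace ℝ E] [MeasurableSpace E] [BorelSpace E] [SecondCountableTopology E]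
    {μ : Measure E} [IsProbabilityMeasure μ] (hsymm : μ.map Neg.neg = μ) {ρ : ℝ}
    (hρ : ∀ᵐ z ∂μ, ‖z‖ ≤ ρ) (x : E) :
    ∫ z, ‖x + z‖ ^ 2 ∂μ = ‖x‖ ^ 2 + ∫ z, ‖z‖ ^ 2 ∂μ := by
  have hinner : Integrable (fun z => 2 * inner ℝ x z) μ := by
    refine Integrable.of_bound (by fun_prop) (2 * (‖x‖ * ρ)) ?_
    filter_upwards [hρ] with z hz
    rw [norm_mul, Real.norm_ofNat]
    gcongr
    exact (norm_inner_le_norm x z).trans (by gcongr)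
  have hsq : Integrable (fun z => ‖z‖ ^ 2) μ := by
    refine Integrable.of_bound (by fun_prop) (ρ ^ 2) ?_
    filter_upwards [hρ] with z hz
    rw [norm_pow, norm_norm]
    gcongr
  have hodd : ∫ z, 2 * inner ℝ x z ∂μ = 0 := by
    have h : ∫ z, 2 * inner ℝ x z ∂μ = ∫ z, 2 * inner ℝ x (-z) ∂μ := by
      conv_lhs => rw [← hsymm]
      exact integral_map measurable_neg.aemeasurable (by fun_prop)
    simp only [inner_neg_right, mul_neg, integral_neg] at h
    linarith
  simp only [norm_add_sq_real]
  rw [integral_add (f := fun z => ‖x‖ ^ 2 + 2 * inner ℝ x z)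
      ((integrable_const _).add hinner) hsq,
    integral_add (integrable_const _) hinner, hodd]
  simp

/-- Existence and uniqueness of bounded solutions of `u x = ∫ u (x + z) d(P x) + F x` in a bounded
set `Ω` with `u = g` outside, for uniformly compactly supported symmetric probability measures `P x`
whose second moments are bounded away from zero. -/
theorem existsUnique_of_symmetric {E : Type*} [NormedAddCommGroup E]
    [InnerProductSpace ℝ E] [MeasurableSpace E] [BorelSpace E] [SecondCountableTopology E]
    (P : E → Measure E) [∀ x, IsProbabilityMeasure (P x)]
    (hsymm : ∀ x, (P x).map Neg.neg = P x) {ρ : ℝ} (hρ : ∀ x, ∀ᵐ z ∂(P x), ‖z‖ ≤ ρ)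
    {a : ℝ} (ha : 0 < a) (haP : ∀ x, a ≤ ∫ z, ‖z‖ ^ 2 ∂(P x))
    (hP : ∀ u : E → ℝ, Measurable u → (∃ M, ∀ x, |u x| ≤ M) →
      Measurable fun x => ∫ z, u (x + z) ∂(P x))
    {Ω : Set E} (hΩ : MeasurableSet Ω) (hΩb : Bornology.IsBounded Ω) {F g : E → ℝ}
    (hF : Measurable F) (hFb : ∃ M, ∀ x, |F x| ≤ M)
    (hg : Measurable g) (hgb : ∃ M, ∀ x, |g x| ≤ M) :
    ∃! u : E → ℝ, Measurable u ∧ (∃ M, ∀ x, |u x| ≤ M) ∧ (∀ x, x ∉ Ω → u x = g x) ∧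
      (∀ x ∈ Ω, u x = ∫ z, u (x + z) ∂(P x) + F x) := by
  obtain ⟨R, hR⟩ := hΩb.subset_closedBall 0
  have hR' : ∀ x ∈ Ω, ‖x‖ ≤ |R| := fun x hx =>
    (mem_closedBall_zero_iff.1 (hR hx)).trans (le_abs_self R)
  let Q : E → Measure E := fun x => (P x).map (x + ·)
  have hQprob : ∀ x, IsProbabilityMeasure (Q x) := fun x =>
    Measure.isProbabilityMeasure_map (by fun_prop)
  have hQint : ∀ (u : E → ℝ), Measurable u → ∀ x, ∫ y, u y ∂(Q x) = ∫ z, u (x + z) ∂(P x) :=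
    fun u hu x => integral_map (by fun_prop) hu.aestronglyMeasurable
  let C := 1 + (|R| + |ρ|) ^ 2 + a
  have hC : 0 < C := by positivity
  have haC : a ≤ C := le_add_of_nonneg_left (by positivity)
  let φ : E → ℝ := fun y => max (C - ‖y‖ ^ 2) 0
  have hφm : Measurable φ := by fun_prop
  have hφle : ∀ y, φ y ≤ C := fun y => max_le (by linarith [sq_nonneg ‖y‖]) hC.le
  have hφeq : ∀ y, ‖y‖ ≤ |R| + |ρ| → φ y = C - ‖y‖ ^ 2 ∧ 1 ≤ φ y := by
    intro y hy
    have h2 : ‖y‖ ^ 2 ≤ (|R| + |ρ|) ^ 2 := by gcongr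
    have h3 : 1 ≤ C - ‖y‖ ^ 2 := by simp only [C]; linarith
    have h4 : φ y = C - ‖y‖ ^ 2 := max_eq_left (by linarith)
    exact ⟨h4, h4 ▸ h3⟩
  have hφΩ : ∀ x ∈ Ω, φ x = C - ‖x‖ ^ 2 ∧ 1 ≤ φ x := fun x hx =>
    hφeq x (by linarith [hR' x hx, abs_nonneg ρ])
  have main := existsUnique_of_barrier Q
    (fun u hu hub => by simp only [hQint u hu]; exact hP u hu hub) hΩ hF hFb hg hgb hφm
    (fun y => le_max_right _ _) hφle (fun x hx => (hφΩ x hx).2)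
    (r := 1 - a / C) (by rw [sub_nonneg]; exact div_le_one_of_le₀ haC hC.le)
    (by linarith [div_pos ha hC]) ?_
  · refine (existsUnique_congr fun u => and_congr_right fun hu => ?_).1 main
    simp only [hQint u hu]
  · intro x hx
    have h1 : ∫ z, φ (x + z) ∂(P x) = ∫ z, (C - ‖x + z‖ ^ 2) ∂(P x) := by
      refine integral_congr_ae ?_
      filter_upwards [hρ x] with z hz
      exact (hφeq _ ((norm_add_le x z).trans
        (add_le_add (hR' x hx) (hz.trans (le_abs_self ρ))))).1
    have h2 : Integrable (fun z => ‖x + z‖ ^ 2) (P x) := by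
      refine Integrable.of_bound (by fun_prop) ((‖x‖ + ρ) ^ 2) ?_
      filter_upwards [hρ x] with z hz
      rw [norm_pow, norm_norm]
      gcongr
      exact (norm_add_le x z).trans (by gcongr)
    rw [hQint φ hφm, h1, integral_sub (integrable_const _) h2,
      integral_norm_add_sq_of_symmetric (hsymm x) (hρ x)]
    have h3 : a / C * φ x ≤ a := by
      rw [div_mul_eq_mul_div, div_le_iff₀ hC]
      exact mul_le_mul_of_nonneg_left (hφle x) ha.le
    have h4 := (hφΩ x hx).1
    simp only [integral_const, probReal_univ, one_smul]
    linarith [haP x]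

/-- If the translates of `ν x` by `x` depend measurably on `x` (tested on bounded functions), then
so do the translates of its dilations. -/
theorem measurable_integral_add_smul {E : Type*} [NormedAddCommGroup E]
    [NormedSpace ℝ E] [MeasurableSpace E] [BorelSpace E] [SecondCountableTopology E]
    (ν : E → Measure E) [∀ x, IsProbabilityMeasure (ν x)]
    (hmeas : ∀ u : E → ℝ, Measurable u → (∃ M, ∀ x, |u x| ≤ M) →
      Measurable fun x => ∫ z, u (x + z) ∂(ν x)) (ε : ℝ) {u : E → ℝ} (hu : Measurable u) :
    Measurable fun x => ∫ z, u (x + ε • z) ∂(ν x) := by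
  have hκ : Measurable fun x => (ν x).map (x + ·) := by
    refine Measure.measurable_of_measurable_coe _ fun s hs => ?_
    have h := hmeas (s.indicator 1) (measurable_one.indicator hs) ⟨1, fun x => by
      by_cases hx : x ∈ s <;> simp [hx]⟩
    have heq : (fun x => (ν x).map (x + ·) s) =
        fun x => ENNReal.ofReal (∫ z, s.indicator 1 (x + z) ∂(ν x)) := by
      funext x
      have : ∫ z, s.indicator (1 : E → ℝ) (x + z) ∂(ν x) =
          ∫ z, ((x + ·) ⁻¹' s).indicator (1 : E → ℝ) z ∂(ν x) := rfl
      rw [this, integral_indicator_one (hs.preimage (by fun_prop)),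
        Measure.map_apply (by fun_prop) hs, ofReal_measureReal]
    rw [heq]
    exact h.ennreal_ofReal
  let κ : Kernel E E := ⟨fun x => (ν x).map (x + ·), hκ⟩
  have : IsMarkovKernel κ := ⟨fun x => Measure.isProbabilityMeasure_map (by fun_prop)⟩
  have h : StronglyMeasurable fun x => ∫ y, u (x + ε • (y - x)) ∂(κ x) :=
    StronglyMeasurable.integral_kernel_prod_right' (κ := κ)
      (f := fun p : E × E => u (p.1 + ε • (p.2 - p.1)))
      (hu.comp (by fun_prop)).stronglyMeasurable
  convert h.measurable using 2 with x
  change _ = ∫ y, u (x + ε • (y - x)) ∂((ν x).map (x + ·))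
  have hux : Measurable fun y => u (x + ε • (y - x)) := hu.comp (by fun_prop)
  rw [integral_map (by fun_prop) hux.aestronglyMeasurable]
  simp

/-- On a set of positive finite measure, the average of `u + c` is the average of `u` plus `c`. -/
theorem setAverage_add_const {E : Type*} [MeasurableSpace E] {μ : Measure E} {s : Set E}
    (hs : μ s ≠ ⊤) (hs0 : μ s ≠ 0) {u : E → ℝ} (hu : IntegrableOn u s μ) (c : ℝ) :
    ⨍ y in s, (u y + c) ∂μ = (⨍ y in s, u y ∂μ) + c := by
  have h0 : μ.real s ≠ 0 := (measureReal_ne_zero_iff hs).2 hs0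
  rw [setAverage_eq, setAverage_eq, integral_add hu (integrableOn_const hs), setIntegral_const]
  simp only [smul_eq_mul]
  field_simp

/-- Existence and uniqueness of the bounded solution of the dynamic programming principle
`u(x) = α ∫ u(x+εz) dν_x(z) + β (⨍_{B_ε(x)} u(y) dy) + ε² f(x)` in `Ω`, `u = g` outside `Ω`, with the
forcing term outside the average. -/
theorem existsUnique_dpp_of_forcing (N : ℕ) (hN : 1 ≤ N) (Λ α β : ℝ)
    (hβ : β ∈ Set.Ioc (0 : ℝ) 1) (hα : α = 1 - β)
    (ν : EuclideanSpace ℝ (Fin N) → Measure (EuclideanSpace ℝ (Fin N)))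
    (hprob : ∀ x, IsProbabilityMeasure (ν x))
    (hsupp : ∀ x, ν x (closedBall (0 : EuclideanSpace ℝ (Fin N)) Λ)ᶜ = 0)
    (hsymm : ∀ x, ∀ s : Set (EuclideanSpace ℝ (Fin N)), MeasurableSet s →
      ν x s = ν x (Neg.neg ⁻¹' s))
    (hmeas : ∀ u : EuclideanSpace ℝ (Fin N) → ℝ, Measurable u → (∃ M, ∀ x, |u x| ≤ M) →
      Measurable fun x => ∫ z, u (x + z) ∂(ν x))
    (Ω : Set (EuclideanSpace ℝ (Fin N))) (hΩopen : IsOpen Ω)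
    (hΩbdd : Bornology.IsBounded Ω)
    (ε : ℝ) (hε : 0 < ε)
    (f g : EuclideanSpace ℝ (Fin N) → ℝ)
    (hf : Measurable f) (hfb : ∃ M, ∀ x, |f x| ≤ M)
    (hg : Measurable g) (hgb : ∃ M, ∀ x, |g x| ≤ M) :
    ∃! u : EuclideanSpace ℝ (Fin N) → ℝ,
      Measurable u ∧ (∃ M, ∀ x, |u x| ≤ M) ∧
      (∀ x, x ∉ Ω → u x = g x) ∧
      (∀ x ∈ Ω, u x = α * ∫ z, u (x + ε • z) ∂(ν x)
        + β * (⨍ y in ball x ε, u y) + ε ^ 2 * f x) := by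
  have hβ0 : 0 ≤ β := hβ.1.le
  have hα0 : 0 ≤ α := by linarith [hβ.2]
  have : Nonempty (Fin N) := ⟨⟨0, hN⟩⟩
  let σ : Measure (EuclideanSpace ℝ (Fin N)) := volume[|ball (0 : EuclideanSpace ℝ (Fin N)) ε]
  have hball0 : volume (ball (0 : EuclideanSpace ℝ (Fin N)) ε) ≠ 0 := (measure_ball_pos _ _ hε).ne'
  have : IsProbabilityMeasure σ := cond_isProbabilityMeasure_of_finite hball0 measure_ball_lt_top.ne
  have hνε : ∀ x, IsProbabilityMeasure ((ν x).map (ε • ·)) := fun x =>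
    Measure.isProbabilityMeasure_map (by fun_prop)
  let P : EuclideanSpace ℝ (Fin N) → Measure (EuclideanSpace ℝ (Fin N)) := fun x =>
    ENNReal.ofReal α • (ν x).map (ε • ·) + ENNReal.ofReal β • σ
  have hPprob : ∀ x, IsProbabilityMeasure (P x) := fun x => ⟨by
    simp only [P, Measure.add_apply, Measure.smul_apply, measure_univ, smul_eq_mul, mul_one]
    rw [← ENNReal.ofReal_add hα0 hβ0, hα, sub_add_cancel, ENNReal.ofReal_one]⟩
  have hσsymm : σ.map Neg.neg = σ := by
    refine Measure.ext fun s hs => ?_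
    rw [Measure.map_apply measurable_neg hs]
    simp only [σ]
    rw [cond_apply measurableSet_ball, cond_apply measurableSet_ball]
    congr 1
    rw [← Measure.measure_preimage_neg volume (ball (0 : EuclideanSpace ℝ (Fin N)) ε ∩ s)]
    congr 1
    ext z
    simp
  have hσball : ∀ᵐ z ∂σ, ‖z‖ < ε := by
    filter_upwards [ae_cond_mem measurableSet_ball] with z hz
    simpa using hz
  have hνball : ∀ x, ∀ᵐ z ∂(ν x).map (ε • ·), ‖z‖ ≤ ε * Λ := by
    intro x
    rw [ae_map_iff (by fun_prop) (measurableSet_le (by fun_prop) (by fun_prop))]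
    have h : ∀ᵐ z ∂(ν x), z ∈ closedBall (0 : EuclideanSpace ℝ (Fin N)) Λ := hsupp x
    filter_upwards [h] with z hz
    rw [norm_smul, Real.norm_of_nonneg hε.le]
    gcongr
    exact mem_closedBall_zero_iff.1 hz
  have hPint : ∀ x (h : EuclideanSpace ℝ (Fin N) → ℝ), Integrable h ((ν x).map (ε • ·)) → Integrable h σ →
      ∫ z, h z ∂(P x) = α * ∫ z, h z ∂((ν x).map (ε • ·)) + β * ∫ z, h z ∂σ := by
    intro x h h1 h2
    simp only [P]
    rw [integral_add_measure (h1.smul_measure ENNReal.ofReal_ne_top)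
      (h2.smul_measure ENNReal.ofReal_ne_top), integral_smul_measure, integral_smul_measure,
      ENNReal.toReal_ofReal hα0, ENNReal.toReal_ofReal hβ0, smul_eq_mul, smul_eq_mul]
  have hσint : ∀ (u : EuclideanSpace ℝ (Fin N) → ℝ) x, ∫ z, u (x + z) ∂σ = ⨍ y in ball x ε, u y := by
    intro u x
    have h1 : ∫ z in ball (0 : EuclideanSpace ℝ (Fin N)) ε, u (x + z) = ∫ y in ball x ε, u y := by
      have := (measurePreserving_add_left volume x).setIntegral_preimage_emb
        (measurableEmbedding_addLeft x) u (ball x ε)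
      rwa [preimage_add_ball, sub_self] at this
    rw [setAverage_eq, ← h1, measureReal_def, Measure.addHaar_ball_center volume x]
    simp only [σ, ProbabilityTheory.cond]
    rw [integral_smul_measure, ENNReal.toReal_inv]
  have hPu : ∀ u : EuclideanSpace ℝ (Fin N) → ℝ, Measurable u → (∃ M, ∀ x, |u x| ≤ M) → ∀ x,
      ∫ z, u (x + z) ∂(P x) = α * ∫ z, u (x + ε • z) ∂(ν x) + β * ⨍ y in ball x ε, u y := by
    rintro u hu ⟨M, hM⟩ x
    have hux : Measurable fun z => u (x + z) := hu.comp (by fun_prop)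
    rw [hPint x _ (integrable_of_measurable_of_bounded hux ⟨M, fun z => hM _⟩)
      (integrable_of_measurable_of_bounded hux ⟨M, fun z => hM _⟩), hσint,
      integral_map (by fun_prop) hux.aestronglyMeasurable]
  have hsqσ : Integrable (fun z : EuclideanSpace ℝ (Fin N) => ‖z‖ ^ 2) σ := by
    refine Integrable.of_bound (by fun_prop) (ε ^ 2) ?_
    filter_upwards [hσball] with z hz
    rw [norm_pow, norm_norm]
    gcongr
  have hc : 0 < ∫ z, ‖z‖ ^ 2 ∂σ := by
    rw [integral_pos_iff_support_of_nonneg (fun z => by positivity) hsqσ]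
    have hs : Function.support (fun z : EuclideanSpace ℝ (Fin N) => ‖z‖ ^ 2) = {0}ᶜ := by
      ext z
      rw [Function.mem_support, Set.mem_compl_singleton_iff, Ne, sq_eq_zero_iff, norm_eq_zero]
    have h0 : σ {0} = 0 := cond_absolutelyContinuous (measure_singleton 0)
    rw [hs, (prob_compl_eq_one_iff (measurableSet_singleton 0)).2 h0]
    exact one_pos
  have main := existsUnique_of_symmetric P (ρ := max (ε * Λ) ε) ?_ ?_ (mul_pos hβ.1 hc) ?_ ?_
    hΩopen.measurableSet hΩbdd (F := fun x => ε ^ 2 * f x) (hf.const_mul _) ?_ hg hgb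
  · refine (existsUnique_congr fun u => and_congr_right fun hu => and_congr_right fun hub => ?_).1
      main
    simp only [hPu u hu hub]
  · intro x
    have hνsymm : ((ν x).map (ε • ·)).map Neg.neg = (ν x).map (ε • ·) := by
      have h : (ν x).map Neg.neg = ν x := Measure.ext fun s hs => by
        rw [Measure.map_apply measurable_neg hs, ← hsymm x s hs]
      conv_rhs => rw [← h]
      rw [Measure.map_map measurable_neg (by fun_prop), Measure.map_map (by fun_prop) measurable_neg]
      congr 1
      funext z
      simp
    simp only [P]
    rw [Measure.map_add _ _ measurable_neg, Measure.map_smul, Measure.map_smul, hνsymm, hσsymm]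
  · intro x
    simp only [P]
    rw [ae_add_measure_iff]
    refine ⟨Measure.ae_smul_measure ?_ _, Measure.ae_smul_measure ?_ _⟩
    · filter_upwards [hνball x] with z hz using le_max_of_le_left hz
    · filter_upwards [hσball] with z hz using le_max_of_le_right hz.le
  · intro x
    rw [hPint x _ _ hsqσ]
    · exact le_add_of_nonneg_left (mul_nonneg hα0 (integral_nonneg fun z => by positivity))
    · refine Integrable.of_bound (by fun_prop) ((ε * Λ) ^ 2) ?_
      filter_upwards [hνball x] with z hz
      rw [norm_pow, norm_norm]
      gcongr
  · intro u hu hub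
    simp only [hPu u hu hub]
    refine ((measurable_integral_add_smul ν hmeas ε hu).const_mul α).add (Measurable.const_mul ?_ β)
    simp only [← hσint]
    exact (StronglyMeasurable.integral_prod_right (ν := σ) (f := fun x z => u (x + z))
      (hu.comp (by fun_prop : Measurable fun p : EuclideanSpace ℝ (Fin N) × EuclideanSpace ℝ (Fin N) => p.1 + p.2)).stronglyMeasurable).measurable
  · obtain ⟨M, hM⟩ := hfb
    exact ⟨ε ^ 2 * M, fun x => by
      rw [abs_mul, abs_of_nonneg (sq_nonneg ε)]
      exact mul_le_mul_of_nonneg_left (hM x) (sq_nonneg ε)⟩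

/-- Let `Ω ⊂ ℝ^N` be a bounded domain, `ε > 0`, and let `f, g : ℝ^N → ℝ` be
bounded Borel measurable functions. Given the parameters `Λ ≥ 1`, `β ∈ (0,1]`, `α = 1 − β`, and
a family `ν` of symmetric probability measures supported in the closed ball of radius `Λ`
(such that `x ↦ ∫ u(x+z) dν_x(z)` is Borel measurable for every bounded Borel measurable `u`),
there exists a unique bounded Borel measurable `u : ℝ^N → ℝ` with `u = g` on `ℝ^N ∖ Ω` and
`u(x) = α ∫ u(x+εz) dν_x(z) + β ⨍_{B_ε(x)} u(y) dy + ε² f(x)` for every `x ∈ Ω`. -/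
theorem dpp_existence_uniqueness (N : ℕ) (hN : 1 ≤ N) (Λ α β : ℝ) (hΛ : 1 ≤ Λ)
    (hβ : β ∈ Set.Ioc (0 : ℝ) 1) (hα : α = 1 - β)
    (ν : EuclideanSpace ℝ (Fin N) → Measure (EuclideanSpace ℝ (Fin N)))
    (hprob : ∀ x, IsProbabilityMeasure (ν x))
    (hsupp : ∀ x, ν x (closedBall (0 : EuclideanSpace ℝ (Fin N)) Λ)ᶜ = 0)
    (hsymm : ∀ x, ∀ s : Set (EuclideanSpace ℝ (Fin N)), MeasurableSet s →
      ν x s = ν x (Neg.neg ⁻¹' s))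
    (hmeas : ∀ u : EuclideanSpace ℝ (Fin N) → ℝ, Measurable u → (∃ M, ∀ x, |u x| ≤ M) →
      Measurable fun x => ∫ z, u (x + z) ∂(ν x))
    (Ω : Set (EuclideanSpace ℝ (Fin N))) (hΩopen : IsOpen Ω) (hΩconn : IsConnected Ω)
    (hΩbdd : Bornology.IsBounded Ω)
    (ε : ℝ) (hε : 0 < ε)
    (f g : EuclideanSpace ℝ (Fin N) → ℝ)
    (hf : Measurable f) (hfb : ∃ M, ∀ x, |f x| ≤ M)
    (hg : Measurable g) (hgb : ∃ M, ∀ x, |g x| ≤ M) :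
    ∃! u : EuclideanSpace ℝ (Fin N) → ℝ,
      Measurable u ∧ (∃ M, ∀ x, |u x| ≤ M) ∧
      (∀ x, x ∉ Ω → u x = g x) ∧
      (∀ x ∈ Ω, u x = α * ∫ z, u (x + ε • z) ∂(ν x)
        + β * ⨍ y in ball x ε, u y + ε ^ 2 * f x) := by
  obtain ⟨M, hM⟩ := hfb
  have main := existsUnique_dpp_of_forcing N hN Λ α β hβ hα ν hprob hsupp hsymm hmeas Ω hΩopen
    hΩbdd ε hε (fun x => β * f x) g (hf.const_mul β)
    ⟨β * M, fun x => by
      rw [abs_mul, abs_of_pos hβ.1]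
      exact mul_le_mul_of_nonneg_left (hM x) hβ.1.le⟩ hg hgb
  refine (existsUnique_congr fun u => and_congr_right fun hu => and_congr_right fun hub =>
    and_congr_right fun _ => forall₂_congr fun x _ => ?_).1 main
  have : IsFiniteMeasure (volume.restrict (ball x ε)) := ⟨by simpa using measure_ball_lt_top⟩
  rw [setAverage_add_const measure_ball_lt_top.ne (measure_ball_pos volume x hε).ne'
    (integrable_of_measurable_of_bounded hu hub)]
  ring_nf
end

section
/- There exist ε₀ > 0, ρ > 0, M ≥ 1 and μ ∈ (0,1), depending only on N, Λ, α, β, such that the following holds: if u is a bounded Borel measurable function on ℝ^N satisfying L_ε^- u ≤ ρ in B_{2√N} and u ≥ 0 in ℝ^N, for some 0 < ε ≤ ε₀, and inf_{Q_3} u ≤ 1, then |{u > M} ∩ Q_1| ≤ μ. -/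
open MeasureTheory Metric

/-- The second-order difference `δu(x,y) = u(x+y) + u(x−y) − 2u(x)`. -/
noncomputable def ddiff {N : ℕ} (u : EuclideanSpace ℝ (Fin N) → ℝ)
    (x y : EuclideanSpace ℝ (Fin N)) : ℝ :=
  u (x + y) + u (x - y) - 2 * u x

/-- The minimal Pucci-type operator
`L_ε^- u(x) = (1/(2ε²))(α·inf_{z ∈ B_Λ} δu(x,εz) + β·⨍_{B_1} δu(x,εy) dy)`. -/
noncomputable def Lminus {N : ℕ} (Λ α β ε : ℝ) (u : EuclideanSpace ℝ (Fin N) → ℝ)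
    (x : EuclideanSpace ℝ (Fin N)) : ℝ :=
  (1 / (2 * ε ^ 2)) *
    (α * sInf ((fun z => ddiff u x (ε • z)) '' ball (0 : EuclideanSpace ℝ (Fin N)) Λ)
      + β * ⨍ y in ball (0 : EuclideanSpace ℝ (Fin N)) 1, ddiff u x (ε • y))

/-- The open axis-parallel cube with center having coordinates `c : Fin N → ℝ` and side
length `r`. -/
def cube {N : ℕ} (c : Fin N → ℝ) (r : ℝ) : Set (EuclideanSpace ℝ (Fin N)) :=
  {y | ∀ i, |y i - c i| < r / 2}

/-- Quadratic lower bound for the hyperbolic cosine. -/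
lemma one_add_sq_div_two_le_cosh (t : ℝ) : 1 + t ^ 2 / 2 ≤ Real.cosh t := by
  have h1 : Real.cosh t = 1 + 2 * Real.sinh (t / 2) ^ 2 := by
    have h := Real.cosh_two_mul (t / 2)
    rw [Real.cosh_sq, mul_div_cancel₀ t two_ne_zero] at h
    linarith
  have h2 : (t / 2) ^ 2 ≤ Real.sinh (t / 2) ^ 2 := by
    rw [sq_le_sq]
    rcases le_total 0 (t / 2) with h | h
    · exact abs_le_abs_of_nonneg h (Real.self_le_sinh_iff.2 h)
    · exact abs_le_abs_of_nonpos h (Real.sinh_le_self_iff.2 h)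
  rw [h1]
  linarith

section Pucci

variable {N : ℕ}

/-- The Gaussian `A * exp (-γ ‖x‖²)`. -/
noncomputable def gaussianBump (A γ : ℝ) (x : EuclideanSpace ℝ (Fin N)) : ℝ :=
  A * Real.exp (-(γ * ‖x‖ ^ 2))

lemma gaussianBump_nonneg {A : ℝ} (hA : 0 ≤ A) (γ : ℝ) (x : EuclideanSpace ℝ (Fin N)) :
    0 ≤ gaussianBump A γ x :=
  mul_nonneg hA (Real.exp_pos _).le

lemma gaussianBump_le {A γ : ℝ} (hA : 0 ≤ A) (hγ : 0 ≤ γ) (x : EuclideanSpace ℝ (Fin N)) :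
    gaussianBump A γ x ≤ A := by
  have : Real.exp (-(γ * ‖x‖ ^ 2)) ≤ 1 := Real.exp_le_one_iff.2 (by
    have : 0 ≤ γ * ‖x‖ ^ 2 := by positivity
    linarith)
  exact mul_le_of_le_one_right hA this

lemma ddiff_gaussianBump (A γ : ℝ) (x h : EuclideanSpace ℝ (Fin N)) :
    ddiff (gaussianBump A γ) x h = 2 * gaussianBump A γ x *
      (Real.exp (-(γ * ‖h‖ ^ 2)) * Real.cosh (2 * γ * inner ℝ x h) - 1) := by
  have e1 : -(γ * ‖x + h‖ ^ 2) =
      -(γ * ‖x‖ ^ 2) + -(γ * ‖h‖ ^ 2) + -(2 * γ * inner ℝ x h) := by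
    rw [norm_add_sq_real]; ring
  have e2 : -(γ * ‖x - h‖ ^ 2) =
      -(γ * ‖x‖ ^ 2) + -(γ * ‖h‖ ^ 2) + 2 * γ * inner ℝ x h := by
    rw [norm_sub_sq_real]; ring
  unfold ddiff gaussianBump
  rw [e1, e2, Real.cosh_eq]
  simp only [Real.exp_add]
  ring

lemma neg_le_ddiff_gaussianBump {A : ℝ} (hA : 0 ≤ A) (γ : ℝ) (x h : EuclideanSpace ℝ (Fin N)) :
    -(2 * gaussianBump A γ x * (γ * ‖h‖ ^ 2)) ≤ ddiff (gaussianBump A γ) x h := by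
  rw [ddiff_gaussianBump, ← mul_neg]
  refine mul_le_mul_of_nonneg_left ?_ (mul_nonneg two_pos.le (gaussianBump_nonneg hA γ x))
  have h1 := Real.add_one_le_exp (-(γ * ‖h‖ ^ 2))
  have h2 := le_mul_of_one_le_right (Real.exp_pos (-(γ * ‖h‖ ^ 2))).le
    (Real.one_le_cosh (2 * γ * inner ℝ x h))
  linarith

lemma le_ddiff_gaussianBump {A γ : ℝ} (hA : 0 ≤ A) {x h : EuclideanSpace ℝ (Fin N)}
    (hh : γ * ‖h‖ ^ 2 ≤ 1 / 2) :
    2 * gaussianBump A γ x * (γ ^ 2 * inner ℝ x h ^ 2 - γ * ‖h‖ ^ 2) ≤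
      ddiff (gaussianBump A γ) x h := by
  rw [ddiff_gaussianBump]
  refine mul_le_mul_of_nonneg_left ?_ (mul_nonneg two_pos.le (gaussianBump_nonneg hA γ x))
  have h1 := Real.add_one_le_exp (-(γ * ‖h‖ ^ 2))
  have h2 := one_add_sq_div_two_le_cosh (2 * γ * inner ℝ x h)
  have h3 : (1 - γ * ‖h‖ ^ 2) * (1 + (2 * γ * inner ℝ x h) ^ 2 / 2) ≤
      Real.exp (-(γ * ‖h‖ ^ 2)) * Real.cosh (2 * γ * inner ℝ x h) :=
    mul_le_mul (by linarith) h2 (by positivity) (Real.exp_pos _).le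
  have h4 : 0 ≤ (γ ^ 2 * inner ℝ x h ^ 2) * (1 - 2 * (γ * ‖h‖ ^ 2)) :=
    mul_nonneg (by positivity) (by linarith)
  nlinarith

/-- A nonnegative function on the unit ball which is at least `c` in a cap has average at least
`4⁻ᴺ c`. -/
lemma mul_le_average_ball {f : EuclideanSpace ℝ (Fin N) → ℝ}
    (hf : IntegrableOn f (ball 0 1)) (hf0 : ∀ y ∈ ball (0 : EuclideanSpace ℝ (Fin N)) 1, 0 ≤ f y)
    (v : EuclideanSpace ℝ (Fin N)) (c : ℝ)
    (h : ∀ y ∈ ball (0 : EuclideanSpace ℝ (Fin N)) 1, ‖v‖ / 2 ≤ inner ℝ v y → c ≤ f y) :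
    (1 / 4) ^ N * c ≤ ⨍ y in ball (0 : EuclideanSpace ℝ (Fin N)) 1, f y := by
  set p : EuclideanSpace ℝ (Fin N) := (3 / 4 : ℝ) • ‖v‖⁻¹ • v with hp
  have hpn : ‖p‖ ≤ 3 / 4 := by
    rw [hp, norm_smul, norm_smul, norm_inv, norm_norm, Real.norm_of_nonneg (by norm_num)]
    have := inv_mul_le_one (a := ‖v‖)
    linarith
  have hpi : inner ℝ v p = 3 / 4 * ‖v‖ := by
    rw [hp, inner_smul_right, inner_smul_right, real_inner_self_eq_norm_sq]
    by_cases hv : ‖v‖ = 0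
    · simp [hv]
    · field_simp
  have hsub : ball p (1 / 4) ⊆ ball 0 1 := by
    apply ball_subset_ball'
    rw [dist_zero_right]
    linarith
  have hcap : ∀ y ∈ ball p (1 / 4), c ≤ f y := by
    intro y hy
    refine h y (hsub hy) ?_
    have h1 := abs_le.1 (abs_real_inner_le_norm v (y - p))
    rw [inner_sub_right, hpi] at h1
    have h2 : ‖v‖ * ‖y - p‖ ≤ ‖v‖ * (1 / 4) :=
      mul_le_mul_of_nonneg_left (by rw [← dist_eq_norm]; exact (mem_ball.1 hy).le) (norm_nonneg v)
    linarith [h1.1]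
  have hvol : volume.real (ball p (1 / 4)) =
      (1 / 4) ^ N * volume.real (ball (0 : EuclideanSpace ℝ (Fin N)) 1) := by
    rw [measureReal_def, Measure.addHaar_ball_of_pos _ _ (by norm_num), finrank_euclideanSpace_fin,
      ENNReal.toReal_mul, ENNReal.toReal_ofReal (by positivity), measureReal_def]
  have hpos : 0 < volume.real (ball (0 : EuclideanSpace ℝ (Fin N)) 1) :=
    ENNReal.toReal_pos (measure_ball_pos _ _ one_pos).ne' measure_ball_lt_top.ne
  rw [setAverage_eq, smul_eq_mul, le_inv_mul_iff₀ hpos]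
  calc volume.real (ball (0 : EuclideanSpace ℝ (Fin N)) 1) * ((1 / 4) ^ N * c)
      = volume.real (ball p (1 / 4)) • c := by rw [hvol, smul_eq_mul]; ring
    _ ≤ ∫ y in ball p (1 / 4), f y :=
      setIntegral_ge_of_const_le measurableSet_ball measure_ball_lt_top.ne hcap (hf.mono_set hsub)
    _ ≤ ∫ y in ball 0 1, f y :=
      setIntegral_mono_set hf ((ae_restrict_iff' measurableSet_ball).2 (ae_of_all _ hf0))
        hsub.eventuallyLE

lemma volume_cube_one_le : volume (cube (fun _ : Fin N => (0 : ℝ)) 1) ≤ 1 := by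
  have h : cube (fun _ : Fin N => (0 : ℝ)) 1 =
      WithLp.ofLp ⁻¹' (Set.univ.pi fun _ : Fin N => Set.Ioo (-(1 / 2) : ℝ) (1 / 2)) := by
    ext y
    simp [cube, abs_lt]
  rw [h, (PiLp.volume_preserving_ofLp (Fin N)).measure_preimage
    (MeasurableSet.univ_pi fun _ => measurableSet_Ioo).nullMeasurableSet, Real.volume_pi_Ioo]
  norm_num

lemma ball_half_subset_cube : ball (0 : EuclideanSpace ℝ (Fin N)) (1 / 2) ⊆
    cube (fun _ : Fin N => (0 : ℝ)) 1 := by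
  intro y hy i
  have := PiLp.norm_apply_le y i
  rw [mem_ball_zero_iff] at hy
  rw [sub_zero, ← Real.norm_eq_abs]
  linarith

lemma norm_sq_le_of_mem_cube {r : ℝ} {y : EuclideanSpace ℝ (Fin N)}
    (hy : y ∈ cube (fun _ : Fin N => (0 : ℝ)) r) : ‖y‖ ^ 2 ≤ N * (r / 2) ^ 2 := by
  rw [EuclideanSpace.norm_sq_eq]
  calc ∑ i, ‖y i‖ ^ 2 ≤ ∑ _i : Fin N, (r / 2) ^ 2 := by
        refine Finset.sum_le_sum fun i _ => ?_
        have := hy i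
        rw [sub_zero, ← Real.norm_eq_abs] at this
        exact pow_le_pow_left₀ (norm_nonneg _) this.le 2
    _ = N * (r / 2) ^ 2 := by simp

lemma measurable_ddiff_smul {u : EuclideanSpace ℝ (Fin N) → ℝ} (hu : Measurable u)
    (x : EuclideanSpace ℝ (Fin N)) (ε : ℝ) : Measurable fun y => ddiff u x (ε • y) := by
  unfold ddiff
  exact ((hu.comp (by fun_prop)).add (hu.comp (by fun_prop))).sub_const _

lemma abs_ddiff_le {u : EuclideanSpace ℝ (Fin N) → ℝ} {K : ℝ} (hK : ∀ x, |u x| ≤ K)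
    (x y : EuclideanSpace ℝ (Fin N)) : |ddiff u x y| ≤ 4 * K := by
  have h1 := abs_le.1 (hK (x + y))
  have h2 := abs_le.1 (hK (x - y))
  have h3 := abs_le.1 (hK x)
  unfold ddiff
  rw [abs_le]
  constructor <;> linarith [h1.1, h1.2, h2.1, h2.2, h3.1, h3.2]

lemma integrableOn_ddiff_smul {u : EuclideanSpace ℝ (Fin N) → ℝ} (hu : Measurable u) {K : ℝ}
    (hK : ∀ x, |u x| ≤ K) (x : EuclideanSpace ℝ (Fin N)) (ε : ℝ) :
    IntegrableOn (fun y => ddiff u x (ε • y)) (ball 0 1) := by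
  have : IsFiniteMeasure (volume.restrict (ball (0 : EuclideanSpace ℝ (Fin N)) 1)) :=
    isFiniteMeasure_restrict.2 measure_ball_lt_top.ne
  exact Integrable.of_bound (measurable_ddiff_smul hu x ε).aestronglyMeasurable (4 * K)
    (ae_of_all _ fun y => abs_ddiff_le hK x _)

/-- `x₀` minimizes `u - φ - ⟪l, ·⟫` over the ball of radius `R` up to an error `η`. -/
def IsNearMin (u φ : EuclideanSpace ℝ (Fin N) → ℝ) (R η : ℝ)
    (l x₀ : EuclideanSpace ℝ (Fin N)) : Prop :=
  x₀ ∈ ball 0 R ∧ ∀ x ∈ ball 0 R, u x₀ - φ x₀ - inner ℝ l x₀ ≤ u x - φ x - inner ℝ l x + η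

lemma exists_isNearMin {u φ : EuclideanSpace ℝ (Fin N) → ℝ} {R η A : ℝ} (hR : 0 < R) (hη : 0 < η)
    (hu : ∀ x, 0 ≤ u x) (hφ : ∀ x, φ x ≤ A) (l : EuclideanSpace ℝ (Fin N)) :
    ∃ x₀, IsNearMin u φ R η l x₀ := by
  set S := (fun x => u x - φ x - inner ℝ l x) '' ball 0 R
  have hne : S.Nonempty := (nonempty_ball.2 hR).image _
  have hbdd : BddBelow S := by
    refine ⟨-A - ‖l‖ * R, ?_⟩
    rintro _ ⟨x, hx, rfl⟩
    have h1 := real_inner_le_norm l x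
    have h2 : ‖l‖ * ‖x‖ ≤ ‖l‖ * R :=
      mul_le_mul_of_nonneg_left (mem_ball_zero_iff.1 hx).le (norm_nonneg l)
    have h3 := hu x
    have h4 := hφ x
    dsimp only
    linarith
  obtain ⟨_, ⟨x₀, hx₀, rfl⟩, h⟩ := exists_lt_of_csInf_lt hne (lt_add_of_pos_right (sInf S) hη)
  refine ⟨x₀, hx₀, fun x hx => h.le.trans ?_⟩
  have := csInf_le hbdd (Set.mem_image_of_mem (fun x => u x - φ x - inner ℝ l x) hx)
  linarith

lemma IsNearMin.ddiff_le {u φ : EuclideanSpace ℝ (Fin N) → ℝ} {R η : ℝ}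
    {l x₀ h : EuclideanSpace ℝ (Fin N)} (hm : IsNearMin u φ R η l x₀)
    (h1 : x₀ + h ∈ ball 0 R) (h2 : x₀ - h ∈ ball 0 R) :
    ddiff φ x₀ h ≤ ddiff u x₀ h + 2 * η := by
  have e1 := hm.2 _ h1
  have e2 := hm.2 _ h2
  rw [inner_add_right] at e1
  rw [inner_sub_right] at e2
  unfold ddiff
  linarith

lemma average_ball_add_const {f : EuclideanSpace ℝ (Fin N) → ℝ} (hf : IntegrableOn f (ball 0 1))
    (c : ℝ) : ⨍ y in ball (0 : EuclideanSpace ℝ (Fin N)) 1, (f y + c) =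
      (⨍ y in ball (0 : EuclideanSpace ℝ (Fin N)) 1, f y) + c := by
  have hpos : 0 < volume.real (ball (0 : EuclideanSpace ℝ (Fin N)) 1) :=
    ENNReal.toReal_pos (measure_ball_pos _ _ one_pos).ne' measure_ball_lt_top.ne
  rw [setAverage_eq, setAverage_eq,
    integral_add hf (integrableOn_const measure_ball_lt_top.ne), setIntegral_const,
    smul_add, smul_smul, inv_mul_cancel₀ hpos.ne', one_smul]

lemma integrableOn_ddiff_smul_add_const {u : EuclideanSpace ℝ (Fin N) → ℝ} (hu : Measurable u)
    {K : ℝ} (hK : ∀ x, |u x| ≤ K) (x : EuclideanSpace ℝ (Fin N)) (ε c : ℝ) :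
    IntegrableOn (fun y => ddiff u x (ε • y) + c) (ball 0 1) :=
  (integrableOn_ddiff_smul hu hK x ε).add (integrableOn_const measure_ball_lt_top.ne)

lemma mul_add_mul_average_le_of_Lminus_le {Λ α β ε ρ a : ℝ} (hε : 0 < ε) (hΛ : 0 < Λ) (hα : 0 ≤ α)
    {u : EuclideanSpace ℝ (Fin N) → ℝ} {x : EuclideanSpace ℝ (Fin N)}
    (hL : Lminus Λ α β ε u x ≤ ρ)
    (ha : ∀ z ∈ ball (0 : EuclideanSpace ℝ (Fin N)) Λ, a ≤ ddiff u x (ε • z)) :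
    α * a + β * ⨍ y in ball (0 : EuclideanSpace ℝ (Fin N)) 1, ddiff u x (ε • y) ≤
      2 * ε ^ 2 * ρ := by
  have h1 : a ≤ sInf ((fun z => ddiff u x (ε • z)) ''
      ball (0 : EuclideanSpace ℝ (Fin N)) Λ) := by
    refine le_csInf ((nonempty_ball.2 hΛ).image _) ?_
    rintro _ ⟨z, hz, rfl⟩
    exact ha z hz
  have h2 := mul_le_mul_of_nonneg_left h1 hα
  unfold Lminus at hL
  rw [one_div, inv_mul_le_iff₀ (by positivity)] at hL
  linarith

lemma add_sub_smul_mem_ball {R Λ ε : ℝ} {x z : EuclideanSpace ℝ (Fin N)} (hε : 0 < ε) (hε1 : ε ≤ 1)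
    (hx : ‖x‖ + Λ ≤ R) (hz : ‖z‖ < Λ) : x + ε • z ∈ ball 0 R ∧ x - ε • z ∈ ball 0 R := by
  have h1 : ‖ε • z‖ < Λ := by
    rw [norm_smul, Real.norm_of_nonneg hε.le]
    exact (mul_le_of_le_one_left (norm_nonneg z) hε1).trans_lt hz
  rw [mem_ball_zero_iff, mem_ball_zero_iff]
  have h2 := norm_add_le x (ε • z)
  have h3 := norm_sub_le x (ε • z)
  constructor <;> linarith

lemma norm_smul_sq_le {ε Λ : ℝ} {z : EuclideanSpace ℝ (Fin N)} (hz : ‖z‖ < Λ) :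
    ‖ε • z‖ ^ 2 ≤ Λ ^ 2 * ε ^ 2 := by
  rw [norm_smul, mul_pow, Real.norm_eq_abs, sq_abs, mul_comm]
  exact mul_le_mul_of_nonneg_right (pow_le_pow_left₀ (norm_nonneg z) hz.le 2) (sq_nonneg ε)

/-- Where the Gaussian is a strict subsolution, it cannot touch a supersolution from below. -/
lemma IsNearMin.norm_lt_of_gaussianBump {Λ β ε ρ A γ R K : ℝ} (hΛ : 1 ≤ Λ) (hβ0 : 0 < β)
    (hβ1 : β ≤ 1) (hε : 0 < ε) (hε1 : ε ≤ 1) (hA : 0 < A) (hγ : 0 < γ) (hγε : γ * ε ^ 2 ≤ 1 / 2)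
    (hβγ : Λ ^ 2 + 1 ≤ β * ((1 / 4) ^ N * (γ / 64)))
    (hρ : 2 * ρ ≤ A * γ * Real.exp (-(γ * (4 * N))))
    {u : EuclideanSpace ℝ (Fin N) → ℝ} (hu : Measurable u) (hK : ∀ x, |u x| ≤ K)
    {l x₀ : EuclideanSpace ℝ (Fin N)} (hm : IsNearMin u (gaussianBump A γ) R (ρ * ε ^ 2) l x₀)
    (hx₀ : ‖x₀‖ < 2 * Real.sqrt N) (hR : 2 * Real.sqrt N + Λ ≤ R)
    (hL : Lminus Λ (1 - β) β ε u x₀ ≤ ρ) : ‖x₀‖ < 1 / 4 := by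
  by_contra! hfar
  set g := gaussianBump A γ x₀ with hg
  have hg0 : 0 ≤ g := gaussianBump_nonneg hA.le γ x₀
  have hmem : ∀ z : EuclideanSpace ℝ (Fin N), ‖z‖ < Λ →
      x₀ + ε • z ∈ ball 0 R ∧ x₀ - ε • z ∈ ball 0 R := fun z hz =>
    add_sub_smul_mem_ball hε hε1 (by linarith) hz
  have hlow : ∀ z : EuclideanSpace ℝ (Fin N), ∀ r, ‖z‖ < r → r ≤ Λ →
      -(2 * g * (γ * (r ^ 2 * ε ^ 2))) - 2 * (ρ * ε ^ 2) ≤ ddiff u x₀ (ε • z) := by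
    intro z r hz hr
    have h1 := hm.ddiff_le (hmem z (hz.trans_le hr)).1 (hmem z (hz.trans_le hr)).2
    have h2 := neg_le_ddiff_gaussianBump hA.le γ x₀ (ε • z)
    have h3 : 2 * g * (γ * ‖ε • z‖ ^ 2) ≤ 2 * g * (γ * (r ^ 2 * ε ^ 2)) := by
      have := norm_smul_sq_le (ε := ε) hz
      gcongr
    linarith
  have hint := integrableOn_ddiff_smul hu hK x₀ ε
  have havg : (1 / 4) ^ N * (2 * g * (γ ^ 2 * (ε ^ 2 * (‖x₀‖ / 2) ^ 2))) ≤
      (⨍ y in ball (0 : EuclideanSpace ℝ (Fin N)) 1, ddiff u x₀ (ε • y)) +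
        (2 * g * (γ * ε ^ 2) + 2 * (ρ * ε ^ 2)) := by
    rw [← average_ball_add_const hint]
    refine mul_le_average_ball (integrableOn_ddiff_smul_add_const hu hK x₀ ε _) ?_ x₀ _ ?_
    · intro y hy
      have := hlow y 1 (mem_ball_zero_iff.1 hy) hΛ
      linarith
    · intro y hy hxy
      have hy1 := mem_ball_zero_iff.1 hy
      have h1 := hm.ddiff_le (hmem y (hy1.trans_le hΛ)).1 (hmem y (hy1.trans_le hΛ)).2
      have h0 : γ * ‖ε • y‖ ^ 2 ≤ γ * ε ^ 2 := by
        have := norm_smul_sq_le (ε := ε) hy1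
        rw [one_pow, one_mul] at this
        gcongr
      have h2 := le_ddiff_gaussianBump (x := x₀) hA.le (h0.trans hγε)
      have h3 : 2 * g * (γ * ‖ε • y‖ ^ 2) ≤ 2 * g * (γ * ε ^ 2) := by gcongr
      have h4 : 2 * g * (γ ^ 2 * (ε ^ 2 * (‖x₀‖ / 2) ^ 2)) ≤
          2 * g * (γ ^ 2 * inner ℝ x₀ (ε • y) ^ 2) := by
        rw [inner_smul_right, mul_pow]
        gcongr
      rw [← hg] at h2
      linarith
  have hmain := mul_add_mul_average_le_of_Lminus_le hε (by linarith : 0 < Λ) (by linarith) hL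
    (fun z hz => hlow z Λ (mem_ball_zero_iff.1 hz) le_rfl)
  have hexp : A * Real.exp (-(γ * (4 * N))) < g := by
    refine mul_lt_mul_of_pos_left (Real.exp_lt_exp.2 ?_) hA
    have h1 : ‖x₀‖ ^ 2 < (2 * Real.sqrt N) ^ 2 := pow_lt_pow_left₀ hx₀ (norm_nonneg _) two_ne_zero
    rw [mul_pow, Real.sq_sqrt (Nat.cast_nonneg N)] at h1
    have := mul_lt_mul_of_pos_left h1 hγ
    linarith
  have hfar2 : (1 / 4 : ℝ) ^ 2 ≤ ‖x₀‖ ^ 2 := pow_le_pow_left₀ (by norm_num) hfar 2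
  have hε2 : 0 < ε ^ 2 := by positivity
  have e1 : β * ((1 / 4) ^ N * (2 * g * (γ ^ 2 * (ε ^ 2 * ((1 / 4) / 2) ^ 2)))) ≤
      β * ((1 / 4) ^ N * (2 * g * (γ ^ 2 * (ε ^ 2 * (‖x₀‖ / 2) ^ 2)))) := by
    gcongr
  have e2 := mul_le_mul_of_nonneg_left havg hβ0.le
  have e3 : (2 * g * γ * ε ^ 2) * (Λ ^ 2 + 1) ≤
      (2 * g * γ * ε ^ 2) * (β * ((1 / 4) ^ N * (γ / 64))) :=
    mul_le_mul_of_nonneg_left hβγ (by positivity)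
  have e4 : (2 * g * γ * ε ^ 2) * ((1 - β) * Λ ^ 2 + β) ≤ (2 * g * γ * ε ^ 2) * Λ ^ 2 := by
    refine mul_le_mul_of_nonneg_left ?_ (by positivity)
    linarith [mul_le_mul_of_nonneg_left (one_le_pow₀ hΛ : 1 ≤ Λ ^ 2) hβ0.le]
  have e5 : (2 * γ * ε ^ 2) * (A * Real.exp (-(γ * (4 * N)))) < (2 * γ * ε ^ 2) * g :=
    mul_lt_mul_of_pos_left hexp (by positivity)
  have e6 := mul_le_mul_of_nonneg_left hρ (by positivity : 0 ≤ 2 * ε ^ 2)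
  linarith

/-- On average over the ball of radius `ε`, a supersolution detaches from a test function at a
contact point by at most a multiple of `ε²`. -/
lemma IsNearMin.average_le {Λ β ε ρ R K c : ℝ} (hΛ : 1 ≤ Λ) (hβ0 : 0 < β)
    (hβ1 : β ≤ 1) (hε : 0 < ε) (hε1 : ε ≤ 1) (hρ1 : ρ ≤ 1) (hc : 0 ≤ c)
    {u φ : EuclideanSpace ℝ (Fin N) → ℝ} (hφ : ∀ x h, -(c * ‖h‖ ^ 2) ≤ ddiff φ x h)
    (hu : Measurable u) (hK : ∀ x, |u x| ≤ K)
    {l x₀ : EuclideanSpace ℝ (Fin N)} (hm : IsNearMin u φ R (ρ * ε ^ 2) l x₀)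
    (hR : ‖x₀‖ + Λ ≤ R) (hL : Lminus Λ (1 - β) β ε u x₀ ≤ ρ) :
    ⨍ y in ball (0 : EuclideanSpace ℝ (Fin N)) 1,
      (ddiff u x₀ (ε • y) + (c * ε ^ 2 + 2 * (ρ * ε ^ 2))) ≤ (4 + c * Λ ^ 2) / β * ε ^ 2 := by
  rw [average_ball_add_const (integrableOn_ddiff_smul hu hK x₀ ε)]
  have hmain := mul_add_mul_average_le_of_Lminus_le (a := -(c * (Λ ^ 2 * ε ^ 2)) - 2 * (ρ * ε ^ 2))
    hε (by linarith : 0 < Λ) (by linarith) hL (fun z hz => by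
      have hz' := mem_ball_zero_iff.1 hz
      have hb := add_sub_smul_mem_ball hε hε1 hR hz'
      have h1 := hm.ddiff_le hb.1 hb.2
      have h2 := hφ x₀ (ε • z)
      have h3 : c * ‖ε • z‖ ^ 2 ≤ c * (Λ ^ 2 * ε ^ 2) :=
        mul_le_mul_of_nonneg_left (norm_smul_sq_le hz') hc
      linarith)
  rw [div_mul_eq_mul_div, le_div_iff₀ hβ0]
  have h1 : (c * ε ^ 2) * ((1 - β) * Λ ^ 2 + β) ≤ (c * ε ^ 2) * Λ ^ 2 := by
    refine mul_le_mul_of_nonneg_left ?_ (by positivity)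
    linarith [mul_le_mul_of_nonneg_left (one_le_pow₀ hΛ : 1 ≤ Λ ^ 2) hβ0.le]
  have h2 := mul_le_mul_of_nonneg_right hρ1 (sq_nonneg ε)
  linarith

lemma IsNearMin.le_ddiff_add {Λ ε ρ R c : ℝ} (hΛ : 1 ≤ Λ)
    (hε : 0 < ε) (hε1 : ε ≤ 1) (hc : 0 ≤ c)
    {u φ : EuclideanSpace ℝ (Fin N) → ℝ} (hφ : ∀ x h, -(c * ‖h‖ ^ 2) ≤ ddiff φ x h)
    {l x₀ y : EuclideanSpace ℝ (Fin N)} (hm : IsNearMin u φ R (ρ * ε ^ 2) l x₀)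
    (hR : ‖x₀‖ + Λ ≤ R) (hy : y ∈ ball 0 1) :
    0 ≤ ddiff u x₀ (ε • y) + (c * ε ^ 2 + 2 * (ρ * ε ^ 2)) ∧
    u (x₀ + ε • y) - u x₀ - (φ (x₀ + ε • y) - φ x₀) - inner ℝ l (ε • y) + ρ * ε ^ 2 ≤
      ddiff u x₀ (ε • y) + (c * ε ^ 2 + 2 * (ρ * ε ^ 2)) := by
  have hy1 := mem_ball_zero_iff.1 hy
  have hb := add_sub_smul_mem_ball hε hε1 hR (hy1.trans_le hΛ)
  have h1 := hm.2 _ hb.1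
  have h2 := hm.2 _ hb.2
  have h3 := hφ x₀ (ε • y)
  have h4 : c * ‖ε • y‖ ^ 2 ≤ c * (1 ^ 2 * ε ^ 2) :=
    mul_le_mul_of_nonneg_left (norm_smul_sq_le hy1) hc
  rw [inner_add_right] at h1
  rw [inner_sub_right] at h2
  unfold ddiff at *
  constructor <;> linarith

/-- Nearby contact points have comparable slopes. -/
lemma IsNearMin.norm_slope_sub_le {Λ ε ρ R K c C : ℝ} (hΛ : 1 ≤ Λ)
    (hε : 0 < ε) (hε1 : ε ≤ 1) (hρ1 : ρ ≤ 1) (hc : 0 ≤ c)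
    {u φ : EuclideanSpace ℝ (Fin N) → ℝ} (hφ : ∀ x h, -(c * ‖h‖ ^ 2) ≤ ddiff φ x h)
    (hu : Measurable u) (hK : ∀ x, |u x| ≤ K)
    {l₀ l₁ x₀ x₁ : EuclideanSpace ℝ (Fin N)} (hm₀ : IsNearMin u φ R (ρ * ε ^ 2) l₀ x₀)
    (hm₁ : IsNearMin u φ R (ρ * ε ^ 2) l₁ x₁) (hR : ‖x₀‖ + Λ ≤ R)
    (havg : ⨍ y in ball (0 : EuclideanSpace ℝ (Fin N)) 1,
      (ddiff u x₀ (ε • y) + (c * ε ^ 2 + 2 * (ρ * ε ^ 2))) ≤ C * ε ^ 2)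
    (hx : dist x₁ x₀ ≤ ε / 4) : ‖l₁ - l₀‖ ≤ 4 * (4 ^ N * C + 1) * ε := by
  have hlow : (1 / 4) ^ N * (‖l₁ - l₀‖ * (ε / 4) - ρ * ε ^ 2) ≤ C * ε ^ 2 := by
    refine le_trans (mul_le_average_ball (integrableOn_ddiff_smul_add_const hu hK x₀ ε _)
      (fun y hy => (hm₀.le_ddiff_add hΛ hε hε1 hc hφ hR hy).1) (l₁ - l₀) _ ?_) havg
    intro y hy hcap
    have hb := add_sub_smul_mem_ball hε hε1 hR ((mem_ball_zero_iff.1 hy).trans_le hΛ)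
    have h1 := (hm₀.le_ddiff_add hΛ hε hε1 hc hφ hR hy).2
    have h2 := hm₀.2 _ hm₁.1
    have h3 := hm₁.2 _ hb.1
    have h4 := real_inner_le_norm (l₁ - l₀) (x₁ - x₀)
    have h5 : ‖l₁ - l₀‖ * ‖x₁ - x₀‖ ≤ ‖l₁ - l₀‖ * (ε / 4) :=
      mul_le_mul_of_nonneg_left (by rwa [← dist_eq_norm]) (norm_nonneg _)
    have h6 := mul_le_mul_of_nonneg_left hcap hε.le
    simp only [inner_add_right, inner_sub_right, inner_sub_left, inner_smul_right] at *
    linarith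
  have h4 : (1 / 4 : ℝ) ^ N * 4 ^ N = 1 := by rw [← mul_pow]; norm_num
  have h5 : ‖l₁ - l₀‖ * (ε / 4) - ρ * ε ^ 2 ≤ 4 ^ N * (C * ε ^ 2) := by
    have := mul_le_mul_of_nonneg_left hlow (by positivity : (0 : ℝ) ≤ 4 ^ N)
    rwa [← mul_assoc, mul_comm ((4 : ℝ) ^ N), h4, one_mul] at this
  have h6 := mul_le_mul_of_nonneg_right hρ1 (sq_nonneg ε)
  refine le_of_mul_le_mul_right ?_ hε
  linarith

/-- Near a contact point the supersolution is bounded on at least half of a small ball. -/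
lemma IsNearMin.volume_closedBall_le {Λ ε ρ R K c C A M : ℝ} (hΛ : 1 ≤ Λ)
    (hε : 0 < ε) (hε1 : ε ≤ 1) (hρ : 0 ≤ ρ) (hc : 0 ≤ c)
    {u φ : EuclideanSpace ℝ (Fin N) → ℝ} (hφ : ∀ x h, -(c * ‖h‖ ^ 2) ≤ ddiff φ x h)
    (hφ0 : ∀ x, 0 ≤ φ x) (hφA : ∀ x, φ x ≤ A)
    (hu : Measurable u) (hK : ∀ x, |u x| ≤ K)
    {l x₀ : EuclideanSpace ℝ (Fin N)} (hm : IsNearMin u φ R (ρ * ε ^ 2) l x₀)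
    (hR : ‖x₀‖ + Λ ≤ R) (hl : ‖l‖ ≤ 1) (hM : u x₀ + A + 2 ≤ M)
    (havg : ⨍ y in ball (0 : EuclideanSpace ℝ (Fin N)) 1,
      (ddiff u x₀ (ε • y) + (c * ε ^ 2 + 2 * (ρ * ε ^ 2))) ≤ C * ε ^ 2)
    (hC : C * ε ^ 2 ≤ 1 / 2 * (1 / 20) ^ N) :
    volume (closedBall x₀ (ε / 20)) ≤ 2 * volume (closedBall x₀ (ε / 20) ∩ {x | u x ≤ M}) := by
  set W : EuclideanSpace ℝ (Fin N) → ℝ :=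
    fun y => ddiff u x₀ (ε • y) + (c * ε ^ 2 + 2 * (ρ * ε ^ 2)) with hW
  set B := ball (0 : EuclideanSpace ℝ (Fin N)) 1
  have hWint : IntegrableOn W B := integrableOn_ddiff_smul_add_const hu hK x₀ ε _
  have hpos : 0 < volume.real B :=
    ENNReal.toReal_pos (measure_ball_pos _ _ one_pos).ne' measure_ball_lt_top.ne
  have hGmeas : MeasurableSet {x | u x ≤ M} := measurableSet_le hu measurable_const
  have hWmeas : MeasurableSet {y | 1 ≤ W y} :=
    measurableSet_le measurable_const ((measurable_ddiff_smul hu x₀ ε).add_const _)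
  have hcheb : volume.real ({y | 1 ≤ W y} ∩ B) ≤ C * ε ^ 2 * volume.real B := by
    have h1 := mul_meas_ge_le_integral_of_nonneg ((ae_restrict_iff' measurableSet_ball).2
      (ae_of_all _ fun y hy => (hm.le_ddiff_add hΛ hε hε1 hc hφ hR hy).1)) hWint 1
    rw [one_mul, measureReal_restrict_apply hWmeas] at h1
    rw [setAverage_eq, smul_eq_mul, inv_mul_le_iff₀ hpos, mul_comm (volume.real B)] at havg
    exact h1.trans havg
  set D := closedBall x₀ (ε / 20) \ {x | u x ≤ M}
  have hsub : (fun y : EuclideanSpace ℝ (Fin N) => ε • y) ⁻¹' ((fun x => x₀ + x) ⁻¹' D) ⊆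
      {y | 1 ≤ W y} ∩ B := by
    rintro y ⟨hy1, hy2⟩
    have hyn : ‖y‖ ≤ 1 / 20 := by
      rw [mem_closedBall, dist_eq_norm, add_sub_cancel_left, norm_smul,
        Real.norm_of_nonneg hε.le] at hy1
      refine le_of_mul_le_mul_left ?_ hε
      linarith
    have hyB : y ∈ B := mem_ball_zero_iff.2 (by linarith)
    refine ⟨?_, hyB⟩
    have h1 := (hm.le_ddiff_add hΛ hε hε1 hc hφ hR hyB).2
    have h2 : M < u (x₀ + ε • y) := not_le.1 hy2
    have h3 := hφA (x₀ + ε • y)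
    have h4 := hφ0 x₀
    have h5 : inner ℝ l (ε • y) ≤ 1 := by
      refine (real_inner_le_norm l (ε • y)).trans ?_
      rw [norm_smul, Real.norm_of_nonneg hε.le]
      exact mul_le_one₀ hl (by positivity) (mul_le_one₀ hε1 (norm_nonneg _) (by linarith))
    have h6 : 0 ≤ ρ * ε ^ 2 := by positivity
    simp only [Set.mem_ofPred_eq, hW]
    linarith
  have hDvol : volume.real D ≤ ε ^ N * (C * ε ^ 2 * volume.real B) := by
    have h1 := (measureReal_mono hsub
      ((measure_mono Set.inter_subset_right).trans_lt measure_ball_lt_top).ne).trans hcheb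
    rw [measureReal_def, Measure.addHaar_preimage_smul _ hε.ne', measure_preimage_add,
      finrank_euclideanSpace_fin, ENNReal.toReal_mul, ENNReal.toReal_ofReal (abs_nonneg _),
      abs_of_pos (by positivity), inv_mul_le_iff₀ (by positivity)] at h1
    exact h1
  have hball : volume.real (closedBall x₀ (ε / 20)) = ε ^ N * ((1 / 20) ^ N * volume.real B) := by
    rw [measureReal_def, Measure.addHaar_closedBall _ _ (by positivity), finrank_euclideanSpace_fin,
      ENNReal.toReal_mul, ENNReal.toReal_ofReal (by positivity), ← measureReal_def,
      div_eq_mul_one_div, mul_pow, mul_assoc]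
  have hsplit := measureReal_inter_add_sdiff (μ := volume) (s := closedBall x₀ (ε / 20)) hGmeas
    measure_closedBall_lt_top.ne
  have hfin : volume (closedBall x₀ (ε / 20) ∩ {x | u x ≤ M}) ≠ ⊤ :=
    ((measure_mono Set.inter_subset_left).trans_lt measure_closedBall_lt_top).ne
  have hreal : volume.real (closedBall x₀ (ε / 20)) ≤
      2 * volume.real (closedBall x₀ (ε / 20) ∩ {x | u x ≤ M}) := by
    have h1 := mul_le_mul_of_nonneg_left (mul_le_mul_of_nonneg_right hC hpos.le)
      (by positivity : 0 ≤ ε ^ N)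
    linarith
  rw [← ENNReal.toReal_le_toReal measure_closedBall_lt_top.ne
    (ENNReal.mul_ne_top ENNReal.ofNat_ne_top hfin), ENNReal.toReal_mul, ENNReal.toReal_ofNat]
  exact hreal

/-- A covering argument: if `x` maps points at distance more than `C r` to points at distance more
than `5 r`, and `G` fills half of each ball of radius `r` around the image of `x`, then the
volume of `G` controls the volume of the domain of `x`. -/
lemma volume_le_of_closedBall_le {r C : ℝ} (hr : 0 < r) (hC : 0 ≤ C)
    {S G : Set (EuclideanSpace ℝ (Fin N))} (hG : MeasurableSet G)
    (x : EuclideanSpace ℝ (Fin N) → EuclideanSpace ℝ (Fin N))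
    (hx : ∀ l ∈ S, ∀ l' ∈ S, dist (x l') (x l) ≤ 5 * r → dist l' l ≤ C * r)
    (hvol : ∀ l ∈ S, volume (closedBall (x l) r) ≤ 2 * volume (closedBall (x l) r ∩ G)) :
    volume S ≤ ENNReal.ofReal (C ^ N) * 2 * volume G := by
  obtain ⟨I, hIS, hdisj, hcov⟩ := Vitali.exists_disjoint_subfamily_covering_enlargement_closedBall
    S x (fun _ => r) r (fun _ _ => le_rfl) 5 (by norm_num)
  have hcount : I.Countable := hdisj.countable_of_nonempty_interior fun i _ =>
    ((nonempty_ball.2 hr).mono ball_subset_interior_closedBall)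
  have hsub : S ⊆ ⋃ i ∈ I, closedBall i (C * r) := by
    intro l hl
    obtain ⟨b, hb, hlb⟩ := hcov l hl
    exact Set.mem_biUnion hb (hx b (hIS hb) l hl (hlb (mem_closedBall_self hr.le)))
  calc volume S ≤ ∑' i : I, volume (closedBall (i : EuclideanSpace ℝ (Fin N)) (C * r)) :=
        (measure_mono hsub).trans (measure_biUnion_le _ hcount _)
    _ ≤ ∑' i : I, ENNReal.ofReal (C ^ N) * 2 * volume (closedBall (x i) r ∩ G) := by
        refine ENNReal.tsum_le_tsum fun i => ?_
        have h := hvol i (hIS i.2)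
        rw [Measure.addHaar_closedBall _ _ hr.le] at h
        rw [Measure.addHaar_closedBall _ _ (by positivity)]
        rw [finrank_euclideanSpace_fin] at *
        rw [mul_pow, ENNReal.ofReal_mul (by positivity), mul_assoc, mul_assoc]
        gcongr
    _ = ENNReal.ofReal (C ^ N) * 2 * volume (⋃ i ∈ I, closedBall (x i) r ∩ G) := by
        rw [ENNReal.tsum_mul_left, measure_biUnion hcount
          (hdisj.mono fun i => Set.inter_subset_left)
          (fun i _ => measurableSet_closedBall.inter hG)]
    _ ≤ ENNReal.ofReal (C ^ N) * 2 * volume G := by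
        gcongr
        exact Set.iUnion₂_subset fun i _ => Set.inter_subset_right

end Pucci

/-- **Lemma `first`.** There exist `ε₀ > 0`, `ρ > 0`, `M ≥ 1` and `μ ∈ (0,1)`,
depending only on `N, Λ, α, β`, such that: if `u` is bounded Borel measurable with
`L_ε^- u ≤ ρ` in `B_{2√N}` and `u ≥ 0` in `ℝ^N`, for some `0 < ε ≤ ε₀`, and `inf_{Q_3} u ≤ 1`,
then `|{u > M} ∩ Q_1| ≤ μ`. -/
theorem measure_estimate_first (N : ℕ) (hN : 1 ≤ N) (Λ α β : ℝ) (hΛ : 1 ≤ Λ)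
    (hβ : β ∈ Set.Ioc (0 : ℝ) 1) (hα : α = 1 - β) :
    ∃ (ε₀ ρ M μ : ℝ), 0 < ε₀ ∧ 0 < ρ ∧ 1 ≤ M ∧ μ ∈ Set.Ioo (0 : ℝ) 1 ∧
      ∀ ε : ℝ, 0 < ε → ε ≤ ε₀ →
        ∀ u : EuclideanSpace ℝ (Fin N) → ℝ,
          Measurable u → (∃ K, ∀ x, |u x| ≤ K) →
          (∀ x ∈ ball (0 : EuclideanSpace ℝ (Fin N)) (2 * Real.sqrt N),
            Lminus Λ α β ε u x ≤ ρ) →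
          (∀ x, 0 ≤ u x) →
          sInf (u '' cube (fun _ : Fin N => (0 : ℝ)) 3) ≤ 1 →
          volume ({x | M < u x} ∩ cube (fun _ : Fin N => (0 : ℝ)) 1) ≤ ENNReal.ofReal μ := by
  obtain ⟨hβ0, hβ1⟩ := hβ
  subst hα
  have hN0 : (1 : ℝ) ≤ N := by exact_mod_cast hN
  have hsqrt : 0 < Real.sqrt N := Real.sqrt_pos.2 (by linarith)
  obtain ⟨γ, hγ, hβγ⟩ : ∃ γ : ℝ, 0 < γ ∧ Λ ^ 2 + 1 ≤ β * ((1 / 4) ^ N * (γ / 64)) := by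
    refine ⟨64 * (Λ ^ 2 + 1) / (β * (1 / 4) ^ N), by positivity, le_of_eq ?_⟩
    field_simp
  obtain ⟨A, hA, hAexp⟩ : ∃ A : ℝ, 0 < A ∧
      A * (Real.exp (-(γ * (N * (3 / 2) ^ 2))) - Real.exp (-(γ * (4 * N)))) = 5 := by
    have hd : 0 < Real.exp (-(γ * (N * (3 / 2) ^ 2))) - Real.exp (-(γ * (4 * N))) := by
      refine sub_pos.2 (Real.exp_lt_exp.2 (neg_lt_neg (mul_lt_mul_of_pos_left ?_ hγ)))
      linarith
    exact ⟨5 / _, div_pos (by norm_num) hd, div_mul_cancel₀ _ hd.ne'⟩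
  set R := 2 * Real.sqrt N + Λ
  have hR1 : 1 ≤ R := by linarith
  set ρ := min 1 (A * γ * Real.exp (-(γ * (4 * N))) / 2)
  have hρ : 0 < ρ := lt_min one_pos (by positivity)
  have hρ1 : ρ ≤ 1 := min_le_left _ _
  have hρ2 : 2 * ρ ≤ A * γ * Real.exp (-(γ * (4 * N))) := by
    have : ρ ≤ A * γ * Real.exp (-(γ * (4 * N))) / 2 := min_le_right _ _
    linarith
  set c := 2 * A * γ
  have hc : 0 ≤ c := by positivity
  set C := (4 + c * Λ ^ 2) / β
  have hC : 0 < C := by positivity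
  set φ : EuclideanSpace ℝ (Fin N) → ℝ := gaussianBump A γ
  have hφ0 : ∀ x, 0 ≤ φ x := gaussianBump_nonneg hA.le γ
  have hφA : ∀ x, φ x ≤ A := gaussianBump_le hA.le hγ.le
  have hφ : ∀ x h, -(c * ‖h‖ ^ 2) ≤ ddiff φ x h := by
    intro x h
    refine le_trans ?_ (neg_le_ddiff_gaussianBump hA.le γ x h)
    have := mul_le_mul_of_nonneg_right (hφA x) (by positivity : 0 ≤ 2 * (γ * ‖h‖ ^ 2))
    linarith
  set S : Set (EuclideanSpace ℝ (Fin N)) := ball 0 (1 / R)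
  set k := 20 * (4 * (4 ^ N * C + 1))
  have hk0 : 0 < k := by positivity
  set m := min (volume.real S / (k ^ N * 2)) (1 / 2)
  have hS0 : 0 < volume.real S :=
    ENNReal.toReal_pos (measure_ball_pos _ _ (by positivity)).ne' measure_ball_lt_top.ne
  have hm0 : 0 < m := lt_min (by positivity) (by norm_num)
  have hm1 : m ≤ 1 / 2 := min_le_right _ _
  refine ⟨min 1 (min (1 / 2 / γ) (1 / 2 * (1 / 20) ^ N / C)), ρ, 2 * A + 8, 1 - m,
    by positivity, hρ, by linarith, ⟨by linarith, by linarith⟩, ?_⟩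
  intro ε hε hεle u hu ⟨K, hK⟩ hL hu0 hinf
  rw [le_min_iff, le_min_iff, le_div_iff₀ hγ, le_div_iff₀ hC] at hεle
  obtain ⟨hε1, hε2, hε3⟩ := hεle
  have hεsq : ε ^ 2 ≤ ε := by
    rw [sq]; exact mul_le_of_le_one_left hε.le hε1
  have hγε : γ * ε ^ 2 ≤ 1 / 2 := by
    linarith [mul_le_mul_of_nonneg_left hεsq hγ.le]
  have hCε : C * ε ^ 2 ≤ 1 / 2 * (1 / 20) ^ N := by
    linarith [mul_le_mul_of_nonneg_left hεsq hC.le]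
  have hη1 : ρ * ε ^ 2 ≤ 1 := mul_le_one₀ hρ1 (sq_nonneg ε) (hεsq.trans hε1)
  obtain ⟨_, ⟨z, hz, rfl⟩, hzu⟩ := exists_lt_of_csInf_lt
    (Set.Nonempty.image u ⟨0, fun i => by simp⟩) (hinf.trans_lt one_lt_two)
  have hzsq := norm_sq_le_of_mem_cube hz
  have hzR : ‖z‖ < R := by
    have h1 : ‖z‖ < 2 * Real.sqrt N := by
      refine lt_of_pow_lt_pow_left₀ 2 (by positivity) ?_
      rw [mul_pow, Real.sq_sqrt (by positivity)]
      linarith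
    linarith
  have hφz : A * Real.exp (-(γ * (N * (3 / 2) ^ 2))) ≤ φ z :=
    mul_le_mul_of_nonneg_left (Real.exp_le_exp.2 (neg_le_neg
      (mul_le_mul_of_nonneg_left hzsq hγ.le))) hA.le
  have htilt : ∀ l ∈ S, ∀ x : EuclideanSpace ℝ (Fin N), ‖x‖ < R → |inner ℝ l x| ≤ 1 := by
    intro l hl x hx
    refine (abs_real_inner_le_norm l x).trans ?_
    calc ‖l‖ * ‖x‖ ≤ 1 / R * R := by
          have := (mem_ball_zero_iff.1 hl).le
          gcongr
      _ = 1 := by field_simp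
  choose x hx using exists_isNearMin (u := u) (φ := φ) (R := R) (η := ρ * ε ^ 2) (A := A)
    (by linarith) (by positivity) hu0 hφA
  have hcompare : ∀ l ∈ S, u (x l) - φ (x l) ≤ 5 - φ z := by
    intro l hl
    have h1 := (hx l).2 z (mem_ball_zero_iff.2 hzR)
    have h2 := abs_le.1 (htilt l hl z hzR)
    have h3 := abs_le.1 (htilt l hl (x l) (mem_ball_zero_iff.1 (hx l).1))
    linarith [h2.1, h3.2]
  have hnorm : ∀ l ∈ S, ‖x l‖ < 2 * Real.sqrt N := by
    intro l hl
    by_contra! hfar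
    have h1 : φ (x l) ≤ A * Real.exp (-(γ * (4 * N))) := by
      refine mul_le_mul_of_nonneg_left (Real.exp_le_exp.2 (neg_le_neg
        (mul_le_mul_of_nonneg_left ?_ hγ.le))) hA.le
      have := pow_le_pow_left₀ (by positivity) hfar 2
      rw [mul_pow, Real.sq_sqrt (by positivity)] at this
      linarith
    have h2 := hcompare l hl
    have h3 := hu0 (x l)
    have h4 := (hx l).2 z (mem_ball_zero_iff.2 hzR)
    have h5 := abs_le.1 (htilt l hl z hzR)
    have h6 := abs_le.1 (htilt l hl (x l) (mem_ball_zero_iff.1 (hx l).1))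
    linarith [h5.1, h6.2]
  have hLx : ∀ l ∈ S, Lminus Λ (1 - β) β ε u (x l) ≤ ρ := fun l hl =>
    hL _ (mem_ball_zero_iff.2 (hnorm l hl))
  have hquarter : ∀ l ∈ S, ‖x l‖ < 1 / 4 := fun l hl =>
    (hx l).norm_lt_of_gaussianBump hΛ hβ0 hβ1 hε hε1 hA hγ hγε hβγ hρ2 hu hK (hnorm l hl) le_rfl
      (hLx l hl)
  have hxR : ∀ l ∈ S, ‖x l‖ + Λ ≤ R := fun l hl => by linarith [hnorm l hl]
  have havg := fun l (hl : l ∈ S) =>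
    (hx l).average_le hΛ hβ0 hβ1 hε hε1 hρ1 hc hφ hu hK (hxR l hl) (hLx l hl)
  set G := {y | u y ≤ 2 * A + 8} ∩ ball (0 : EuclideanSpace ℝ (Fin N)) (1 / 2)
  have hGmeas : MeasurableSet G := (measurableSet_le hu measurable_const).inter measurableSet_ball
  have hcover : volume S ≤ ENNReal.ofReal (k ^ N) * 2 * volume G := by
    refine volume_le_of_closedBall_le (r := ε / 20) (by positivity) hk0.le hGmeas x ?_ ?_
    · intro l hl l' hl' hd
      have := (hx l).norm_slope_sub_le hΛ hε hε1 hρ1 hc hφ hu hK (hx l') (hxR l hl) (havg l hl)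
        (by linarith)
      rw [dist_eq_norm]
      linarith
    · intro l hl
      have hl1 : ‖l‖ ≤ 1 := (mem_ball_zero_iff.1 hl).le.trans (div_le_one_of_le₀ hR1 (by linarith))
      refine ((hx l).volume_closedBall_le (M := 2 * A + 8) hΛ hε hε1 hρ.le hc hφ hφ0 hφA hu hK
        (hxR l hl) hl1 ?_ (havg l hl) hCε).trans ?_
      · linarith [hcompare l hl, hφ0 z, hφA (x l)]
      · gcongr 2 * volume ?_
        refine Set.subset_inter Set.inter_subset_left fun y hy => ⟨hy.2, ?_⟩
        have h1 := mem_closedBall.1 hy.1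
        rw [dist_eq_norm] at h1
        have h2 := norm_le_norm_add_norm_sub' y (x l)
        rw [mem_ball_zero_iff]
        linarith [hquarter l hl]
  have hGtop : volume G ≠ ⊤ :=
    ((measure_mono Set.inter_subset_right).trans_lt measure_ball_lt_top).ne
  have hmG : m ≤ volume.real G := by
    refine (min_le_left _ _).trans ?_
    rw [div_le_iff₀ (by positivity)]
    have := ENNReal.toReal_mono (by finiteness) hcover
    rw [ENNReal.toReal_mul, ENNReal.toReal_mul, ENNReal.toReal_ofReal (by positivity),
      ENNReal.toReal_ofNat, ← measureReal_def, ← measureReal_def] at this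
    linarith
  have hdisj : Disjoint ({y | 2 * A + 8 < u y} ∩ cube (fun _ : Fin N => (0 : ℝ)) 1) G :=
    Set.disjoint_left.2 fun y hy hy' =>
      not_lt_of_ge (show u y ≤ 2 * A + 8 from hy'.1) (show 2 * A + 8 < u y from hy.1)
  have hunion : volume ({y | 2 * A + 8 < u y} ∩ cube (fun _ : Fin N => (0 : ℝ)) 1) + volume G ≤
      1 := by
    rw [← measure_union hdisj hGmeas]
    exact (measure_mono (Set.union_subset Set.inter_subset_right
      (Set.inter_subset_right.trans ball_half_subset_cube))).trans volume_cube_one_le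
  have hle : ENNReal.ofReal m ≤ volume G := by
    rw [← ENNReal.ofReal_toReal hGtop]
    exact ENNReal.ofReal_le_ofReal hmG
  rw [ENNReal.ofReal_sub _ hm0.le, ENNReal.ofReal_one]
  exact ENNReal.le_sub_of_add_le_right ENNReal.ofReal_ne_top ((add_le_add_right hle _).trans hunion)
end
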